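/- arXiv:2211.06109 — 7 statements merged into one kernel-verified Lean document; each statement's English description precedes it below -/
import Mathlib

section
/- Let G be a digraph, r = ⟨H, H', B, c⟩ a boundary VCP reduction, and suppose Π(G) = G' + V(H) + E(H) for an undirected graph G' such that r is applicable to G'. Assume (i) all arcs of G incident to any vertex v ∈ V(H) \ B are bi-edges, and (ii) every arc (u,w) ∈ E(G) is a bi-edge or satisfies |{u,w} ∩ B| ≤ 1. Let G* be the digraph obtained from G by deleting the vertices V(H) \ B, deleting all arcs in B×B, adding the vertices V(H'), and adding both arcs (u,v) and (v,u) for every edge {u,v} ∈ E(H'). Then DFVS(G) = DFVS(G*) + c. -/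
namespace DFVSP

open scoped Classical

noncomputable section

variable {V : Type*} [DecidableEq V]

/-- An undirected graph: a finite vertex set together with a finite edge set. -/
structure UGraph (V : Type*) where
  verts : Finset V
  edges : Finset (Sym2 V)

/-- Well-formedness: all endpoints of edges are vertices. -/
def UGraph.WF (H : UGraph V) : Prop := ∀ e ∈ H.edges, ∀ x ∈ e, x ∈ H.verts

/-- `D` is a vertex cover of `H`: `D ⊆ V(H)` and every edge has an endpoint in `D`. -/
def IsVC (H : UGraph V) (D : Finset V) : Prop :=
  D ⊆ H.verts ∧ ∀ e ∈ H.edges, ∃ x ∈ D, x ∈ e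

/-- `VC(H)`: the minimum cardinality of a vertex cover of `H`. -/
def vcNum (H : UGraph V) : ℕ :=
  sInf {n | ∃ D : Finset V, IsVC H D ∧ D.card = n}

/-- `D` is a vertex cover of `H` of minimum cardinality. -/
def IsMinVC (H : UGraph V) (D : Finset V) : Prop :=
  IsVC H D ∧ ∀ D' : Finset V, IsVC H D' → D.card ≤ D'.card

/-- `H − X`: delete the vertices of `X` together with all incident edges. -/
def UGraph.delete (H : UGraph V) (X : Finset V) : UGraph V :=
  ⟨H.verts \ X, H.edges.filter fun e => ¬ ∃ x ∈ X, x ∈ e⟩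

/-- `G + V(H) + E(H)`: add the vertices and edges of `H` to `G`. -/
def UGraph.union (G H : UGraph V) : UGraph V :=
  ⟨G.verts ∪ H.verts, G.edges ∪ H.edges⟩

/-- `v` is isolated in `H`: it lies on no edge. -/
def Isolated (H : UGraph V) (v : V) : Prop := ∀ e ∈ H.edges, v ∉ e

/-- `⟨H, H', B, c⟩` is a boundary VCP reduction: `B ⊆ V(H) ∩ V(H')` consists of
vertices that are non-isolated in both `H` and `H'`, and for all `X ⊆ B` we have
`VC(H − X) = VC(H' − X) + c`. -/
def IsBoundaryRed (H H' : UGraph V) (B : Finset V) (c : ℤ) : Prop :=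
  B ⊆ H.verts ∧ B ⊆ H'.verts ∧
  (∀ b ∈ B, ¬ Isolated H b ∧ ¬ Isolated H' b) ∧
  ∀ X : Finset V, X ⊆ B → (vcNum (H.delete X) : ℤ) = (vcNum (H'.delete X) : ℤ) + c

/-- The reduction `⟨H, H', B, c⟩` is applicable to `G`: the vertices of `B` are
non-isolated in `G`, form an independent set in `G`, and
`V(G) ∩ V(H) = B = V(G) ∩ V(H')`. -/
def Applicable (H H' G : UGraph V) (B : Finset V) : Prop :=
  (∀ b ∈ B, ¬ Isolated G b) ∧
  (∀ b ∈ B, ∀ b' ∈ B, s(b, b') ∉ G.edges) ∧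
  G.verts ∩ H.verts = B ∧ G.verts ∩ H'.verts = B

/-- A digraph: a finite vertex set together with a finite arc set. -/
structure DgraphV (V : Type*) where
  verts : Finset V
  arcs : Finset (V × V)

/-- Well-formedness: all endpoints of arcs are vertices. -/
def DgraphV.WF (G : DgraphV V) : Prop :=
  ∀ a ∈ G.arcs, a.1 ∈ G.verts ∧ a.2 ∈ G.verts

/-- `p` is a cycle in `G`: a list of vertices `v₁,…,vₙ` with `n ≥ 2`, consecutive
vertices joined by arcs, and `v₁ = vₙ`. -/
def IsCycleV (G : DgraphV V) (p : List V) : Prop :=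
  List.Chain' (fun a b => (a, b) ∈ G.arcs) p ∧ 2 ≤ p.length ∧ p.head? = p.getLast?

/-- `D` is a DFVS of `G`: `D ⊆ V(G)` and every cycle contains a vertex of `D`. -/
def IsDFVSV (G : DgraphV V) (D : Finset V) : Prop :=
  D ⊆ G.verts ∧ ∀ p : List V, IsCycleV G p → ∃ x ∈ p, x ∈ D

/-- `DFVS(G)`: the minimum cardinality of a DFVS of `G`. -/
def dfvsNumV (G : DgraphV V) : ℕ :=
  sInf {n | ∃ D : Finset V, IsDFVSV G D ∧ D.card = n}

/-- `Π(G)`: the undirected graph on `V(G)` whose edges are the bi-edges of `G`. -/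
def piGraph (G : DgraphV V) : UGraph V :=
  ⟨G.verts, (G.arcs.filter fun a => (a.2, a.1) ∈ G.arcs).image fun a => s(a.1, a.2)⟩

/-- `G*`: delete the vertices `V(H) \ B` and all arcs in `B × B` from `G`, add the
vertices of `H'`, and add both arcs `(u, v)` and `(v, u)` for every edge
`{u, v} ∈ E(H')`. -/
def gStar (G : DgraphV V) (H H' : UGraph V) (B : Finset V) : DgraphV V :=
  ⟨(G.verts \ (H.verts \ B)) ∪ H'.verts,
    (G.arcs.filter fun a =>
        a.1 ∉ H.verts \ B ∧ a.2 ∉ H.verts \ B ∧ ¬ (a.1 ∈ B ∧ a.2 ∈ B)) ∪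
      ((H'.verts ×ˢ H'.verts).filter fun a => s(a.1, a.2) ∈ H'.edges)⟩

/-- The digraph on `W ∪ V(H)` with arc set `R` together with both orientations of every
edge of `H`. -/
def glue (W : Finset V) (R : Finset (V × V)) (H : UGraph V) : DgraphV V :=
  ⟨W ∪ H.verts, R ∪ (H.verts ×ˢ H.verts).filter fun a => s(a.1, a.2) ∈ H.edges⟩

lemma UGraph.WF.delete {H : UGraph V} (h : H.WF) (X : Finset V) : (H.delete X).WF := by
  intro e he x hx
  simp only [UGraph.delete, Finset.mem_filter, Finset.mem_sdiff] at he ⊢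
  exact ⟨h e he.1 x hx, fun hX => he.2 ⟨x, hX, hx⟩⟩

lemma vcNum_le {H : UGraph V} {D : Finset V} (h : IsVC H D) : vcNum H ≤ D.card :=
  Nat.sInf_le ⟨D, h, rfl⟩

lemma UGraph.WF.exists_isVC_card_eq {H : UGraph V} (h : H.WF) :
    ∃ D, IsVC H D ∧ D.card = vcNum H := by
  refine Nat.sInf_mem (s := {n | ∃ D : Finset V, IsVC H D ∧ D.card = n})
    ⟨_, H.verts, ⟨subset_rfl, fun e he => ?_⟩, rfl⟩
  induction e with
  | _ a b => exact ⟨a, h _ he a (Sym2.mem_mk_left a b), Sym2.mem_mk_left a b⟩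

lemma dfvsNumV_le {G : DgraphV V} {D : Finset V} (h : IsDFVSV G D) : dfvsNumV G ≤ D.card :=
  Nat.sInf_le ⟨D, h, rfl⟩

lemma DgraphV.WF.exists_isDFVSV_card_eq {G : DgraphV V} (h : G.WF) :
    ∃ D, IsDFVSV G D ∧ D.card = dfvsNumV G := by
  refine Nat.sInf_mem (s := {n | ∃ D : Finset V, IsDFVSV G D ∧ D.card = n})
    ⟨_, G.verts, ⟨subset_rfl, ?_⟩, rfl⟩
  rintro p ⟨hp, hlen, -⟩
  match p, hp, hlen with
  | a :: b :: l, hp, _ => exact ⟨a, by simp, (h _ (List.isChain_cons_cons.1 hp).1).1⟩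

lemma mem_or_mem_of_isChain {α : Type*} {r : α → α → Prop} {p : List α} (hp : p.IsChain r)
    (hlen : 2 ≤ p.length) {x : α} (hx : x ∈ p) : ∃ y, r x y ∨ r y x := by
  obtain ⟨i, hi, rfl⟩ := List.getElem_of_mem hx
  rw [List.isChain_iff_getElem] at hp
  by_cases h : i + 1 < p.length
  · exact ⟨_, Or.inl (hp i h)⟩
  · obtain ⟨j, rfl⟩ : ∃ j, i = j + 1 := ⟨i - 1, by omega⟩
    exact ⟨_, Or.inr (hp j hi)⟩

lemma isChain_or_exists_of_isChain_or {α : Type*} {r s : α → α → Prop} {p : List α}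
    (hp : p.IsChain fun a b => r a b ∨ s a b) :
    p.IsChain r ∨ ∃ a ∈ p, ∃ b ∈ p, s a b := by
  rw [or_iff_not_imp_right]
  intro hs
  rw [List.isChain_iff_getElem] at hp ⊢
  exact fun i hi => (hp i hi).resolve_right fun h =>
    hs ⟨_, List.getElem_mem _, _, List.getElem_mem _, h⟩

lemma IsDFVSV.isVC_inter {W : Finset V} {R : Finset (V × V)} {H : UGraph V} (hH : H.WF)
    {D : Finset V} (hD : IsDFVSV (glue W R H) D) : IsVC H (D ∩ H.verts) := by
  refine ⟨Finset.inter_subset_right, fun e he => ?_⟩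
  induction e with
  | _ a b =>
    have ha := hH _ he a (Sym2.mem_mk_left a b)
    have hb := hH _ he b (Sym2.mem_mk_right a b)
    have he' : s(b, a) ∈ H.edges := Sym2.eq_swap ▸ he
    have hchain : [a, b, a].IsChain fun a b => (a, b) ∈ (glue W R H).arcs := by
      simp [glue, ha, hb, he, he']
    obtain ⟨x, hx, hxD⟩ := hD.2 [a, b, a] ⟨hchain, by simp, by simp⟩
    have hx' : x = a ∨ x = b := by simp at hx; tauto
    rcases hx' with rfl | rfl
    · exact ⟨x, by simp [hxD, ha], by simp⟩
    · exact ⟨x, by simp [hxD, hb], by simp⟩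

lemma IsVC.sdiff {H : UGraph V} {C : Finset V} (hC : IsVC H C) (X : Finset V) :
    IsVC (H.delete X) (C \ X) := by
  refine ⟨Finset.sdiff_subset_sdiff hC.1 subset_rfl, fun e he => ?_⟩
  simp only [UGraph.delete, Finset.mem_filter] at he
  obtain ⟨x, hx, hxe⟩ := hC.2 e he.1
  exact ⟨x, Finset.mem_sdiff.2 ⟨hx, fun hX => he.2 ⟨x, hX, hxe⟩⟩, hxe⟩

/-- Replacing the glued graph keeps the part of a DFVS inside `W` and exchanges the rest for
a vertex cover of the new graph minus the boundary vertices already chosen. -/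
lemma IsDFVSV.union_isVC {W B : Finset V} {R : Finset (V × V)} {H H' : UGraph V}
    (hR : ∀ a ∈ R, a.1 ∈ W ∧ a.2 ∈ W) {D C : Finset V} (hD : IsDFVSV (glue W R H) D)
    (hC : IsVC (H'.delete (D ∩ B)) C) (hB : B ⊆ W) :
    IsDFVSV (glue W R H') (D ∩ W ∪ C) := by
  refine ⟨Finset.union_subset_union Finset.inter_subset_right
    (hC.1.trans Finset.sdiff_subset), ?_⟩
  rintro p ⟨hp, hlen, hends⟩
  have hp' : p.IsChain fun a b => (a, b) ∈ R ∨ s(a, b) ∈ H'.edges :=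
    hp.imp fun a b hab => by
      simp only [glue, Finset.mem_union, Finset.mem_filter] at hab
      exact hab.imp_right And.right
  rcases isChain_or_exists_of_isChain_or hp' with hpR | ⟨a, ha, b, hb, hab⟩
  · obtain ⟨x, hxp, hxD⟩ := hD.2 p
      ⟨hpR.imp fun a b h => Finset.mem_union_left _ h, hlen, hends⟩
    refine ⟨x, hxp, Finset.mem_union_left _ (Finset.mem_inter.2 ⟨hxD, ?_⟩)⟩
    obtain ⟨y, h | h⟩ := mem_or_mem_of_isChain hpR hlen hxp
    exacts [(hR _ h).1, (hR _ h).2]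
  · have hmem : ∀ x ∈ s(a, b), x ∈ p := by
      intro x hx
      rcases Sym2.mem_iff.1 hx with rfl | rfl <;> assumption
    by_cases hX : ∃ x ∈ D ∩ B, x ∈ s(a, b)
    · obtain ⟨x, hxX, hx⟩ := hX
      obtain ⟨hxD, hxB⟩ := Finset.mem_inter.1 hxX
      exact ⟨x, hmem x hx, Finset.mem_union_left _ (Finset.mem_inter.2 ⟨hxD, hB hxB⟩)⟩
    · obtain ⟨x, hxC, hx⟩ := hC.2 s(a, b) (Finset.mem_filter.2 ⟨hab, hX⟩)
      exact ⟨x, hmem x hx, Finset.mem_union_right _ hxC⟩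

lemma dfvsNumV_glue_le {W B : Finset V} {R : Finset (V × V)} {H H' : UGraph V} {k : ℤ}
    (hR : ∀ a ∈ R, a.1 ∈ W ∧ a.2 ∈ W) (hH : H.WF) (hH' : H'.WF) (hWH : W ∩ H.verts = B)
    (hk : ∀ X ⊆ B, (vcNum (H'.delete X) : ℤ) ≤ vcNum (H.delete X) + k) :
    (dfvsNumV (glue W R H') : ℤ) ≤ dfvsNumV (glue W R H) + k := by
  have hwf : (glue W R H).WF := by
    intro a ha
    simp only [glue, Finset.mem_union, Finset.mem_filter, Finset.mem_product] at ha ⊢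
    rcases ha with ha | ha
    · exact (hR a ha).imp Or.inl Or.inl
    · exact ha.1.imp Or.inr Or.inr
  obtain ⟨D, hD, hDcard⟩ := hwf.exists_isDFVSV_card_eq
  obtain ⟨C, hC, hCcard⟩ := (hH'.delete (D ∩ B)).exists_isVC_card_eq
  have h1 := dfvsNumV_le (hD.union_isVC hR hC (hWH ▸ Finset.inter_subset_left))
  have h2 := vcNum_le ((hD.isVC_inter hH).sdiff (D ∩ B))
  have h3 := hk (D ∩ B) Finset.inter_subset_right
  have h4 := Finset.card_union_le (D ∩ W) C
  have h5 : (D ∩ W).card + ((D ∩ H.verts) \ (D ∩ B)).card ≤ D.card := by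
    rw [← Finset.card_union_of_disjoint]
    · exact Finset.card_le_card (by grind)
    · rw [Finset.disjoint_left, ← hWH]
      grind
  omega

/-- lifting a boundary VCP reduction to DFVSP. -/
theorem boundary_reduction_lifts_to_dfvs
    (G : DgraphV V) (G' H H' : UGraph V) (B : Finset V) (c : ℤ)
    (hwfG : G.WF) (hwfG' : G'.WF) (hwfH : H.WF) (hwfH' : H'.WF)
    (hred : IsBoundaryRed H H' B c)
    (hPi : piGraph G = UGraph.union G' H)
    (happ : Applicable H H' G' B)
    (hbiedge : ∀ a ∈ G.arcs,
      (a.1 ∈ H.verts \ B ∨ a.2 ∈ H.verts \ B) → (a.2, a.1) ∈ G.arcs)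
    (harcs : ∀ a ∈ G.arcs,
      (a.2, a.1) ∈ G.arcs ∨ (({a.1, a.2} : Finset V) ∩ B).card ≤ 1) :
    (dfvsNumV G : ℤ) = (dfvsNumV (gStar G H H' B) : ℤ) + c := by
  obtain ⟨-, hindep, hWH, hWH'⟩ := happ
  have hverts : G.verts = G'.verts ∪ H.verts := congrArg UGraph.verts hPi
  have hedges : ∀ a b, ((a, b) ∈ G.arcs ∧ (b, a) ∈ G.arcs) ↔
      (s(a, b) ∈ G'.edges ∨ s(a, b) ∈ H.edges) := by
    intro a b
    have h : s(a, b) ∈ (piGraph G).edges ↔ s(a, b) ∈ (UGraph.union G' H).edges := by rw [hPi]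
    simp only [piGraph, UGraph.union, Finset.mem_union, Finset.mem_image, Finset.mem_filter,
      Prod.exists] at h
    rw [← h]
    constructor
    · exact fun hab => ⟨a, b, hab, rfl⟩
    · rintro ⟨x, y, hxy, he⟩
      rcases Sym2.eq_iff.1 he with ⟨rfl, rfl⟩ | ⟨rfl, rfl⟩
      exacts [hxy, hxy.symm]
  have hW : G.verts \ (H.verts \ B) = G'.verts := by
    rw [hverts, ← hWH]
    grind
  set R := G.arcs.filter fun a =>
    a.1 ∉ H.verts \ B ∧ a.2 ∉ H.verts \ B ∧ ¬ (a.1 ∈ B ∧ a.2 ∈ B) with hRdef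
  have hstar : gStar G H H' B = glue G'.verts R H' := by
    simp only [gStar, glue, hW, hRdef]
  have hR : ∀ a ∈ R, a.1 ∈ G'.verts ∧ a.2 ∈ G'.verts := by
    intro a ha
    obtain ⟨haG, h1, h2, -⟩ := Finset.mem_filter.1 ha
    rw [← hW]
    exact ⟨Finset.mem_sdiff.2 ⟨(hwfG a haG).1, h1⟩, Finset.mem_sdiff.2 ⟨(hwfG a haG).2, h2⟩⟩
  have harc : ∀ a b, (a, b) ∈ G.arcs ↔
      (a, b) ∈ R ∨ (a ∈ H.verts ∧ b ∈ H.verts) ∧ s(a, b) ∈ H.edges := by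
    intro a b
    constructor
    · intro hab
      by_cases habR : (a, b) ∈ R
      · exact Or.inl habR
      right
      have hcase : (a ∈ H.verts \ B ∨ b ∈ H.verts \ B) ∨ (a ∈ B ∧ b ∈ B) := by
        simp only [hRdef, Finset.mem_filter] at habR
        tauto
      have hba : (b, a) ∈ G.arcs := by
        rcases hcase with h | ⟨ha, hb⟩
        · exact hbiedge _ hab h
        · rcases harcs _ hab with h | h
          · exact h
          · have hsub : ({a, b} : Finset V) ∩ B = {a, b} :=
              Finset.inter_eq_left.2 (by grind)
            obtain rfl : a = b :=
              Finset.card_le_one.1 (hsub ▸ h) a (by simp) b (by simp)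
            exact hab
      have hH : s(a, b) ∈ H.edges := by
        refine ((hedges a b).1 ⟨hab, hba⟩).resolve_left fun hG' => ?_
        have ha' := hwfG' _ hG' a (Sym2.mem_mk_left a b)
        have hb' := hwfG' _ hG' b (Sym2.mem_mk_right a b)
        rcases hcase with h | ⟨ha, hb⟩
        · grind
        · exact hindep a ha b hb hG'
      exact ⟨⟨hwfH _ hH a (Sym2.mem_mk_left a b), hwfH _ hH b (Sym2.mem_mk_right a b)⟩, hH⟩
    · rintro (h | ⟨-, h⟩)
      · exact (Finset.mem_filter.1 h).1
      · exact ((hedges a b).2 (Or.inr h)).1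
  have hG : G = glue G'.verts R H := by
    obtain ⟨Gv, Ga⟩ := G
    simp only [glue, DgraphV.mk.injEq]
    refine ⟨hverts, ?_⟩
    ext ⟨a, b⟩
    simpa only [Finset.mem_union, Finset.mem_filter, Finset.mem_product] using harc a b
  have hle := dfvsNumV_glue_le (k := c) hR hwfH' hwfH hWH' fun X hX => (hred.2.2.2 X hX).le
  have hge := dfvsNumV_glue_le (k := -c) hR hwfH hwfH' hWH fun X hX => by
    have := hred.2.2.2 X hX
    omega
  rw [← hG, ← hstar] at hle hge
  omega

end

end DFVSP
end

section
/- (Soundness of DOME++) Let G be a loop-free digraph and (v,u) ∈ E(G) an arc with (u,v) ∉ E(G) such that either (i) every path in G that starts at v and ends at u uses a bi-edge or a vertex from N_pre(u) \ {v}, or (ii) every path in G that starts at u and ends at v uses a bi-edge or a vertex from N_succ(v) \ {u}. Then a set S ⊆ V(G) is a DFVS of G if and only if S is a DFVS of G − (v,u); in particular DFVS(G) = DFVS(G − (v,u)). -/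
namespace DFVSP

open scoped Classical

noncomputable section

variable {V : Type*} [Fintype V] [DecidableEq V]

/-- A digraph on the (finite) vertex set `V` is given by its finite set of arcs. -/
abbrev Dgraph (V : Type*) := Finset (V × V)

/-- `p` is a path in `G`: a list of vertices where consecutive vertices are joined by arcs. -/
def IsPath (G : Dgraph V) (p : List V) : Prop :=
  List.Chain' (fun a b => (a, b) ∈ G) p

/-- `p` is a path in `G` that starts at `a` and ends at `b`. -/
def IsPathFrom (G : Dgraph V) (a b : V) (p : List V) : Prop :=
  IsPath G p ∧ p.head? = some a ∧ p.getLast? = some b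

/-- `p` is a cycle in `G`: a path `v₁,…,vₙ` with `n ≥ 2` and `v₁ = vₙ`. -/
def IsCycle (G : Dgraph V) (p : List V) : Prop :=
  IsPath G p ∧ 2 ≤ p.length ∧ p.head? = p.getLast?

/-- `D` is a directed feedback vertex set of `G`: every cycle contains a vertex of `D`. -/
def IsDFVS (G : Dgraph V) (D : Finset V) : Prop :=
  ∀ p : List V, IsCycle G p → ∃ x ∈ p, x ∈ D

/-- The minimum cardinality of a DFVS of `G`. -/
def dfvsNum (G : Dgraph V) : ℕ :=
  sInf {n | ∃ D : Finset V, IsDFVS G D ∧ D.card = n}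

/-- `D` is a DFVS of `G` of minimum cardinality. -/
def IsMinDFVS (G : Dgraph V) (D : Finset V) : Prop :=
  IsDFVS G D ∧ ∀ D' : Finset V, IsDFVS G D' → D.card ≤ D'.card

/-- The predecessors of `v` in `G`. -/
def Npre (G : Dgraph V) (v : V) : Finset V := Finset.univ.filter fun p => (p, v) ∈ G

/-- The successors of `v` in `G`. -/
def Nsucc (G : Dgraph V) (v : V) : Finset V := Finset.univ.filter fun s => (v, s) ∈ G

/-- The bi-edge neighbours of `v` in `G`. -/
def Nbi (G : Dgraph V) (v : V) : Finset V := Npre G v ∩ Nsucc G v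

/-- The neighbours of `v` in `G`. -/
def Nbhd (G : Dgraph V) (v : V) : Finset V := Npre G v ∪ Nsucc G v

/-- The consecutive pairs of vertices along a list. -/
def consecutivePairs (p : List V) : List (V × V) := p.zip p.tail

/-- The path `p` uses a bi-edge of `G`. -/
def UsesBiEdge (G : Dgraph V) (p : List V) : Prop :=
  ∃ q ∈ consecutivePairs p, (q.1, q.2) ∈ G ∧ (q.2, q.1) ∈ G

/-- A path (or cycle) `p` is uncovered in `G` if there is no cycle whose vertex set is a
proper subset of the vertex set of `p`. -/
def Uncovered (G : Dgraph V) (p : List V) : Prop :=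
  ¬ ∃ q : List V, IsCycle G q ∧ q.toFinset ⊂ p.toFinset

/-- `G − v`: delete the vertex `v` together with all incident arcs. -/
def deleteVertex (G : Dgraph V) (v : V) : Dgraph V :=
  G.filter fun a => a.1 ≠ v ∧ a.2 ≠ v

/-- `G[A]`: the subdigraph induced by the vertex set `A`. -/
def induce (G : Dgraph V) (A : Finset V) : Dgraph V :=
  G.filter fun a => a.1 ∈ A ∧ a.2 ∈ A

/-- The exclusion `G ∘ v`: delete `v` and add an arc `(p, s)` for every predecessor `p`
and successor `s` of `v`. -/
def exclude (G : Dgraph V) (v : V) : Dgraph V :=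
  deleteVertex G v ∪ Npre G v ×ˢ Nsucc G v

/-- A diclique: all pairs of distinct vertices of `S` are joined by bi-edges. -/
def IsDiclique (G : Dgraph V) (S : Finset V) : Prop :=
  ∀ u ∈ S, ∀ w ∈ S, u ≠ w → (u, w) ∈ G ∧ (w, u) ∈ G

/-- The arc relation of `G` restricted to the vertices outside `S`. -/
def AvoidingArc (G : Dgraph V) (S : Finset V) (a b : V) : Prop :=
  (a, b) ∈ G ∧ a ∉ S ∧ b ∉ S

theorem rel_of_mem_consecutivePairs {α : Type*} {r : α → α → Prop} {p : List α}
    (hp : p.IsChain r) {q : α × α} (hq : q ∈ consecutivePairs p) : r q.1 q.2 := by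
  induction p with
  | nil => simp [consecutivePairs] at hq
  | cons a l ih =>
    cases l with
    | nil => simp [consecutivePairs] at hq
    | cons b l =>
      rw [List.isChain_cons_cons] at hp
      simp only [consecutivePairs, List.tail_cons, List.zip_cons_cons, List.mem_cons] at hq
      rcases hq with rfl | hq
      · exact hp.1
      · exact ih hp.2 hq

theorem reflTransGen_head_of_mem {α : Type*} {r : α → α → Prop} {a : α} {l : List α}
    (hl : (a :: l).IsChain r) {x : α} (hx : x ∈ a :: l) : Relation.ReflTransGen r a x := by
  induction l generalizing a with
  | nil => simp_all [Relation.ReflTransGen.refl]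
  | cons b l ih =>
    rw [List.isChain_cons_cons] at hl
    rcases List.mem_cons.1 hx with rfl | hx
    · exact .refl
    · exact .head hl.1 (ih hl.2 hx)

theorem reflTransGen_getLast_of_mem {α : Type*} {r : α → α → Prop} {p : List α}
    (hp : p.IsChain r) {x b : α} (hx : x ∈ p) (hb : p.getLast? = some b) :
    Relation.ReflTransGen r x b := by
  obtain ⟨s, t, rfl⟩ := List.append_of_mem hx
  refine reflTransGen_head_of_mem hp.right_of_append ?_
  rw [List.getLast?_append_cons] at hb
  exact List.mem_of_getLast? hb

theorem isDFVS_iff_forall_not_transGen {α : Type*} (G : Dgraph α) (S : Finset α) :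
    IsDFVS G S ↔ ∀ a, ¬ Relation.TransGen (AvoidingArc G S) a a := by
  constructor
  · intro h a ha
    obtain ⟨b, hab, hba⟩ := Relation.TransGen.head'_iff.1 ha
    obtain ⟨l, hl, hlast⟩ := List.exists_isChain_cons_of_relationReflTransGen hba
    have hchain : (a :: b :: l).IsChain (AvoidingArc G S) := List.isChain_cons_cons.2 ⟨hab, hl⟩
    have hlast' : (b :: l).getLast? = some a := by
      rw [List.getLast?_eq_some_getLast (List.cons_ne_nil _ _), hlast]
    obtain ⟨x, hx, hxS⟩ := h (a :: b :: l)
      ⟨hchain.imp fun _ _ h => h.1, by simp, by rw [List.getLast?_cons_cons, hlast']; rfl⟩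
    have hxa : Relation.ReflTransGen (AvoidingArc G S) x a :=
      reflTransGen_getLast_of_mem hchain hx (by rw [List.getLast?_cons_cons, hlast'])
    rcases hxa.cases_head with rfl | ⟨c, hxc, -⟩
    · exact hab.2.1 hxS
    · exact hxc.2.1 hxS
  · intro h p hp
    by_contra! hS
    obtain ⟨hpath, hlen, hends⟩ := hp
    match p, hlen with
    | a :: b :: l, _ =>
      have hchain : (a :: b :: l).IsChain (AvoidingArc G S) :=
        List.IsChain.imp_of_mem_imp (fun x y hx hy hxy => ⟨hxy, hS x hx, hS y hy⟩) hpath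
      refine h a (.head' (List.isChain_cons_cons.1 hchain).1 ?_)
      exact reflTransGen_getLast_of_mem hchain (by simp) hends.symm

theorem IsDFVS.mono {α : Type*} {G H : Dgraph α} (hHG : H ⊆ G) {S : Finset α} (h : IsDFVS G S) :
    IsDFVS H S :=
  fun p hp => h p ⟨List.IsChain.imp (fun _ _ hab => hHG hab) hp.1, hp.2⟩

/-- A walk outside `S` either avoids the arc `(v, u)`, or it splits at the first and the last
use of that arc. -/
theorem transGen_erase_or {α : Type*} [DecidableEq α] {G : Dgraph α} {v u : α} {S : Finset α}
    {a b : α} (h : Relation.TransGen (AvoidingArc G S) a b) :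
    Relation.TransGen (AvoidingArc (G.erase (v, u)) S) a b ∨
      Relation.ReflTransGen (AvoidingArc (G.erase (v, u)) S) a v ∧
        Relation.ReflTransGen (AvoidingArc (G.erase (v, u)) S) u b := by
  have step {x y : α} (hxy : AvoidingArc G S x y) :
      AvoidingArc (G.erase (v, u)) S x y ∨ x = v ∧ y = u := by
    by_cases hne : (x, y) = (v, u)
    · exact .inr (Prod.mk.inj hne)
    · exact .inl ⟨Finset.mem_erase.2 ⟨hne, hxy.1⟩, hxy.2⟩
  induction h with
  | single hab =>
    rcases step hab with hab | ⟨rfl, rfl⟩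
    · exact .inl (.single hab)
    · exact .inr ⟨.refl, .refl⟩
  | tail _ hbc ih =>
    rcases step hbc with hbc | ⟨rfl, rfl⟩
    · exact ih.imp (.tail · hbc) (And.imp_right (.tail · hbc))
    · exact .inr ⟨ih.elim (·.to_reflTransGen) And.left, .refl⟩

/-- If every path from `u` to `v` uses a bi-edge or a successor of `v` other than `u`, then
removing the arc `(v, u)` does not create new directed feedback vertex sets. -/
theorem IsDFVS.of_erase {G : Dgraph V} {v u : V} (hloopfree : ∀ x : V, (x, x) ∉ G)
    (huv : (u, v) ∉ G)
    (hdom : ∀ p : List V, IsPathFrom G u v p →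
      UsesBiEdge G p ∨ ∃ x ∈ p, x ∈ Nsucc G v ∧ x ≠ u)
    {S : Finset V} (h : IsDFVS (G.erase (v, u)) S) : IsDFVS G S := by
  rw [isDFVS_iff_forall_not_transGen] at h ⊢
  intro a ha
  obtain haa | ⟨hav, hua⟩ := transGen_erase_or (v := v) (u := u) ha
  · exact h a haa
  obtain ⟨l, hl, hlast⟩ := List.exists_isChain_cons_of_relationReflTransGen (hua.trans hav)
  have hlast' : (u :: l).getLast? = some v := by
    rw [List.getLast?_eq_some_getLast (List.cons_ne_nil _ _), hlast]
  obtain ⟨q, hq, -, hq'⟩ | ⟨x, hx, hxv, hxu⟩ :=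
    hdom (u :: l) ⟨hl.imp fun _ _ h => Finset.mem_of_mem_erase h.1, rfl, hlast'⟩
  · have hqR := rel_of_mem_consecutivePairs hl hq
    refine h q.1 (.tail (.single hqR) ⟨Finset.mem_erase.2 ⟨fun heq => huv ?_, hq'⟩,
      hqR.2.2, hqR.2.1⟩)
    obtain ⟨h2, h1⟩ := Prod.mk.inj heq
    rw [← h1, ← h2]
    exact Finset.mem_of_mem_erase hqR.1
  · have hvx : (v, x) ∈ G := (Finset.mem_filter.1 hxv).2
    have hxv' := reflTransGen_getLast_of_mem hl hx hlast'
    rcases hxv'.cases_head with rfl | ⟨c, hxc, -⟩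
    · exact hloopfree _ hvx
    rcases hxv'.cases_tail with rfl | ⟨d, -, hdv⟩
    · exact hloopfree _ hvx
    refine h v (.head' ⟨Finset.mem_erase.2 ⟨fun heq => hxu (Prod.mk.inj heq).2, hvx⟩,
      hdv.2.2, hxc.2.1⟩ hxv')

/-- soundness of DOME++. -/
theorem domePlusPlus_sound (G : Dgraph V) (v u : V)
    (hloopfree : ∀ x : V, (x, x) ∉ G)
    (hvu : (v, u) ∈ G) (huv : (u, v) ∉ G)
    (hdom :
      (∀ p : List V, IsPathFrom G v u p →
        UsesBiEdge G p ∨ ∃ x ∈ p, x ∈ Npre G u ∧ x ≠ v) ∨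
      (∀ p : List V, IsPathFrom G u v p →
        UsesBiEdge G p ∨ ∃ x ∈ p, x ∈ Nsucc G v ∧ x ≠ u)) :
    (∀ S : Finset V, IsDFVS G S ↔ IsDFVS (G.erase (v, u)) S) ∧
      dfvsNum G = dfvsNum (G.erase (v, u)) := by
  have key (S : Finset V) : IsDFVS G S ↔ IsDFVS (G.erase (v, u)) S := by
    refine ⟨IsDFVS.mono (Finset.erase_subset _ _), fun h => ?_⟩
    rcases hdom with hdom | hdom
    · -- The path `[v, u]` consisting of the arc itself refutes this alternative.
      exfalso
      obtain ⟨q, hq, -, hq'⟩ | ⟨x, hx, hxu, hxv⟩ :=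
        hdom [v, u] ⟨List.isChain_pair.2 hvu, rfl, rfl⟩
      · obtain rfl : q = (v, u) := by simpa [consecutivePairs] using hq
        exact huv hq'
      · obtain rfl : x = u := by simpa [hxv] using hx
        exact hloopfree _ (Finset.mem_filter.1 hxu).2
    · exact h.of_erase hloopfree huv hdom
  exact ⟨key, by simp only [dfvsNum, key]⟩

end

end DFVSP
end

section
/- (Soundness of ALLCYCLES) Let G be a loop-free digraph and (v,u) ∈ E(G) an arc such that every cycle of G that traverses the arc (v,u), i.e., visits u immediately after v, is covered. Then a set S ⊆ V(G) is a DFVS of G if and only if S is a DFVS of G − (v,u); in particular DFVS(G) = DFVS(G − (v,u)). -/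
namespace DFVSP

open scoped Classical

noncomputable section

variable {V : Type*} [Fintype V] [DecidableEq V]

/-- A path that does not use the arc `e` is a path after removing `e`. -/
theorem IsPath.erase {G : Dgraph V} {e : V × V} {p : List V} (hp : IsPath G p)
    (he : e ∉ consecutivePairs p) : IsPath (G.erase e) p := by
  unfold IsPath List.Chain' at *
  induction p with
  | nil => exact List.isChain_nil
  | cons a l ih =>
    cases l with
    | nil => exact List.isChain_singleton a
    | cons b l =>
      rw [List.isChain_cons_cons] at hp ⊢
      simp only [consecutivePairs, List.tail_cons, List.zip_cons_cons, List.mem_cons,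
        not_or] at he ih
      exact ⟨Finset.mem_erase.2 ⟨Ne.symm he.1, hp.1⟩, ih hp.2 he.2⟩

/-- A cycle of a subdigraph is a cycle of the digraph. -/
theorem IsCycle.mono {G H : Dgraph V} (h : H ⊆ G) {p : List V} (hp : IsCycle H p) :
    IsCycle G p :=
  ⟨hp.1.imp fun _ _ hab => h hab, hp.2⟩

/-- A DFVS is determined by the uncovered cycles. -/
theorem isDFVS_of_uncovered {G : Dgraph V} {S : Finset V}
    (h : ∀ p : List V, IsCycle G p → Uncovered G p → ∃ x ∈ p, x ∈ S) : IsDFVS G S := by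
  intro p
  induction hs : p.toFinset using Finset.strongInduction generalizing p with
  | H s ih =>
    subst hs
    intro hp
    by_cases hu : Uncovered G p
    · exact h p hp hu
    · obtain ⟨q, hq, hqp⟩ := not_not.1 hu
      obtain ⟨x, hxq, hxS⟩ := ih q.toFinset hqp q rfl hq
      exact ⟨x, List.mem_toFinset.1 (hqp.1 (List.mem_toFinset.2 hxq)), hxS⟩

/-- soundness of ALLCYCLES. -/
theorem allcycles_sound (G : Dgraph V) (v u : V)
    (hloopfree : ∀ x : V, (x, x) ∉ G)
    (hvu : (v, u) ∈ G)
    (hcovered : ∀ p : List V, IsCycle G p → (v, u) ∈ consecutivePairs p →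
      ¬ Uncovered G p) :
    (∀ S : Finset V, IsDFVS G S ↔ IsDFVS (G.erase (v, u)) S) ∧
      dfvsNum G = dfvsNum (G.erase (v, u)) := by
  have key : ∀ S : Finset V, IsDFVS G S ↔ IsDFVS (G.erase (v, u)) S := fun S =>
    ⟨fun h p hp => h p (hp.mono (Finset.erase_subset _ _)), fun h =>
      isDFVS_of_uncovered fun p hp hu =>
        h p ⟨hp.1.erase fun hmem => hcovered p hp hmem hu, hp.2⟩⟩
  refine ⟨key, ?_⟩
  simp only [dfvsNum, key]

end

end DFVSP
end

section
/- (Soundness of MANYFOLD) Let G be a loop-free digraph to which the PIE reduction is not applicable, and let v* ∈ V(G) satisfy N(v*) = N_bi(v*). Suppose there is a partition (C_1, C_2) of N(v*) such that: |C_1| ≥ |C_2|; G[C_1] and G[C_2] are dicliques; letting M be the set of ordered pairs (c,d) of distinct vertices of N(v*) with (c,d) ∉ E(G), every (c,d) ∈ M satisfies either ((d,c) ∈ M and there is no uncovered path between c and d) or ((d,c) ∉ M and every uncovered path from d to c uses the arc (d,c)); and for each c_1 ∈ C_1 there is exactly one vertex c_2(c_1) ∈ C_2 such that (c_1,c_2(c_1))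 ∈ M or (c_2(c_1),c_1) ∈ M. Let G' be the digraph obtained from G by deleting v* and all vertices of C_2, adding for each c_1 ∈ C_1 all arcs in {c_1}×N_succ(c_2(c_1)) and in N_pre(c_2(c_1))×{c_1}, and deleting any resulting loops (c_1,c_1). Then DFVS(G) = DFVS(G') + |C_2|. -/
namespace DFVSP

open scoped Classical

noncomputable section

variable {V : Type*} [Fintype V] [DecidableEq V]

/-- There is no uncovered path (in either direction) between `x` and `y`. -/
def NoUncoveredPathBetween (G : Dgraph V) (x y : V) : Prop :=
  ¬ ∃ p : List V, (IsPathFrom G x y p ∨ IsPathFrom G y x p) ∧ Uncovered G p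

/-- `(c, d)` is a non-arc of `G[N(v)]`: an ordered pair of distinct neighbours of `v`
with `(c, d) ∉ E(G)`. -/
def inM (G : Dgraph V) (v c d : V) : Prop :=
  c ∈ Nbhd G v ∧ d ∈ Nbhd G v ∧ c ≠ d ∧ (c, d) ∉ G

/-- The digraph obtained from `G` by the MANYFOLD reduction on `v*` with partition
`(C₁, C₂)` and matching `f`: delete `v*` and the vertices of `C₂`, add for each
`c₁ ∈ C₁` all arcs in `{c₁} × N_succ(c₂(c₁))` and `N_pre(c₂(c₁)) × {c₁}`, and delete
any resulting loops `(c₁, c₁)`. -/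
def manyfoldGraph (G : Dgraph V) (vstar : V) (C1 C2 : Finset V) (f : V → V) :
    Dgraph V :=
  (G ∪ C1.biUnion fun c1 => ({c1} ×ˢ Nsucc G (f c1)) ∪ (Npre G (f c1) ×ˢ {c1})).filter
    fun a => a.1 ∉ insert vstar C2 ∧ a.2 ∉ insert vstar C2 ∧ a.1 ≠ a.2

set_option linter.unusedSectionVars false

/-- `(a, b)` is an arc of `G` both of whose ends avoid `D`. -/
def AvoidArc (G : Dgraph V) (D : Finset V) (a b : V) : Prop :=
  (a, b) ∈ G ∧ a ∉ D ∧ b ∉ D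

theorem exists_list_of_transGen {r : V → V → Prop} {P : V → Prop}
    (hr : ∀ a b, r a b → P a ∧ P b) {a b : V} (h : Relation.TransGen r a b) :
    ∃ p : List V, List.IsChain r p ∧ p.head? = some a ∧ p.getLast? = some b ∧
      2 ≤ p.length ∧ (∀ x ∈ p, P x) ∧ ∀ q ∈ consecutivePairs p, r q.1 q.2 := by
  induction h using Relation.TransGen.head_induction_on with
  | @single a h =>
    refine ⟨[a, b], by simpa using h, rfl, rfl, by simp, ?_, ?_⟩
    · simpa using hr _ _ h
    · simpa [consecutivePairs] using h
  | @head a c h _ ih =>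
    obtain ⟨p, h1, h2, h3, h4, h5, h6⟩ := ih
    obtain _ | ⟨d, t⟩ := p
    · simp at h2
    obtain rfl : d = c := by simpa using h2
    refine ⟨a :: d :: t, List.isChain_cons_cons.2 ⟨h, h1⟩, rfl, ?_, ?_, ?_, ?_⟩
    · simpa using h3
    · simp
    · intro x hx
      rcases List.mem_cons.1 hx with rfl | hx
      · exact (hr _ _ h).1
      · exact h5 x hx
    · intro q hq
      rcases List.mem_cons.1 hq with rfl | hq
      · exact h
      · exact h6 q hq

theorem transGen_of_isPath {G : Dgraph V} {D : Finset V} (l : List V) :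
    ∀ a b c : V, IsPath G (a :: b :: l) → (∀ x ∈ a :: b :: l, x ∉ D) →
      (a :: b :: l).getLast? = some c → Relation.TransGen (AvoidArc G D) a c := by
  induction l with
  | nil =>
    intro a b c hp hD hc
    obtain rfl : b = c := by simpa using hc
    have h : (a, b) ∈ G := (List.isChain_cons_cons.1 hp).1
    exact .single ⟨h, hD a (by simp), hD b (by simp)⟩
  | cons d l ih =>
    intro a b c hp hD hc
    obtain ⟨h, hp⟩ := List.isChain_cons_cons.1 hp
    refine .head ⟨h, hD a (by simp), hD b (by simp)⟩
      (ih b d c hp (fun x hx => hD x (List.mem_cons_of_mem _ hx)) ?_)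
    simpa using hc

theorem isDFVS_iff {G : Dgraph V} {D : Finset V} :
    IsDFVS G D ↔ ∀ x, ¬ Relation.TransGen (AvoidArc G D) x x := by
  constructor
  · intro hD x hx
    obtain ⟨p, h1, h2, h3, h4, h5, -⟩ :=
      exists_list_of_transGen (P := fun y => y ∉ D) (fun _ _ h => h.2) hx
    obtain ⟨y, hy, hyD⟩ := hD p ⟨h1.imp fun _ _ h => h.1, h4, h2.trans h3.symm⟩
    exact h5 y hy hyD
  · intro h p hp
    by_contra! hD
    obtain ⟨h1, h2, h3⟩ := hp
    obtain _ | ⟨a, _ | ⟨b, l⟩⟩ := p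
    · simp at h2
    · simp at h2
    · exact h a (transGen_of_isPath l a b a h1 hD h3.symm)

theorem exists_isDFVS_card_eq_dfvsNum (G : Dgraph V) :
    ∃ D : Finset V, IsDFVS G D ∧ D.card = dfvsNum G := by
  refine Nat.sInf_mem (s := {n | ∃ D : Finset V, IsDFVS G D ∧ D.card = n})
    ⟨_, Finset.univ, ?_, rfl⟩
  rintro (_ | ⟨a, p⟩) hp
  · simp [IsCycle] at hp
  · exact ⟨a, by simp⟩

theorem dfvsNum_le {G : Dgraph V} {D : Finset V} (h : IsDFVS G D) : dfvsNum G ≤ D.card :=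
  Nat.sInf_le ⟨D, h, rfl⟩

/-- Merging a set `K` of pairwise unreachable vertices of an acyclic relation `r` keeps it
acyclic. -/
theorem acyclic_of_merge {r s : V → V → Prop} (K : Set V)
    (hr : ∀ x, ¬ Relation.TransGen r x x)
    (hK : ∀ c ∈ K, ∀ d ∈ K, ¬ Relation.TransGen r c d)
    (hs : ∀ a b, s a b → ∃ a' b', (a = a' ∨ a ∈ K ∧ a' ∈ K) ∧ (b' = b ∨ b' ∈ K ∧ b ∈ K) ∧
      r a' b') (x : V) : ¬ Relation.TransGen s x x := by
  have key : ∀ a b, Relation.TransGen s a b →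
      ∃ a' b', (a = a' ∨ a ∈ K ∧ a' ∈ K) ∧ (b' = b ∨ b' ∈ K ∧ b ∈ K) ∧
        (Relation.TransGen r a' b' ∨
          ∃ c ∈ K, ∃ d ∈ K, Relation.TransGen r a' c ∧ Relation.TransGen r d b') := by
    intro a b h
    induction h with
    | single h =>
      obtain ⟨a', b', h1, h2, h3⟩ := hs _ _ h
      exact ⟨a', b', h1, h2, .inl (.single h3)⟩
    | tail _ h ih =>
      obtain ⟨b'', c', h1, h2, h3⟩ := hs _ _ h
      obtain ⟨a', b', h4, h5, h6⟩ := ih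
      refine ⟨a', c', h4, h2, ?_⟩
      have hE : b' = b'' ∨ b' ∈ K ∧ b'' ∈ K := by
        rcases h5 with rfl | h5
        · exact h1
        · rcases h1 with rfl | h1
          · exact .inr h5
          · exact .inr ⟨h5.1, h1.2⟩
      rcases hE with rfl | ⟨hb', hb''⟩
      · rcases h6 with h6 | ⟨c, hc, d, hd, h6, h7⟩
        · exact .inl (h6.tail h3)
        · exact .inr ⟨c, hc, d, hd, h6, h7.tail h3⟩
      · rcases h6 with h6 | ⟨c, hc, d, hd, h6, h7⟩
        · exact .inr ⟨b', hb', b'', hb'', h6, .single h3⟩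
        · exact (hK d hd b' hb' h7).elim
  intro hx
  obtain ⟨a', b', h1, h2, h3⟩ := key x x hx
  have hE : b' = a' ∨ b' ∈ K ∧ a' ∈ K := by
    rcases h2 with rfl | h2
    · exact h1
    · rcases h1 with rfl | h1
      · exact .inr h2
      · exact .inr ⟨h2.1, h1.2⟩
  rcases hE with rfl | ⟨hb', ha'⟩
  · rcases h3 with h3 | ⟨c, hc, d, hd, h3, h4⟩
    · exact hr _ h3
    · exact hK d hd c hc (h4.trans h3)
  · rcases h3 with h3 | ⟨c, hc, d, hd, h3, h4⟩
    · exact hK _ ha' _ hb' h3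
    · exact hK _ ha' _ hc h3

theorem mem_manyfoldGraph {G : Dgraph V} {v : V} {C1 C2 : Finset V} {f : V → V} {a b : V} :
    (a, b) ∈ manyfoldGraph G v C1 C2 f ↔
      ((a, b) ∈ G ∨ (a ∈ C1 ∧ (f a, b) ∈ G) ∨ (b ∈ C1 ∧ (a, f b) ∈ G)) ∧
        a ∉ insert v C2 ∧ b ∉ insert v C2 ∧ a ≠ b := by
  simp only [manyfoldGraph, Finset.mem_filter, Finset.mem_union, Finset.mem_biUnion,
    Finset.mem_product, Finset.mem_singleton, Nsucc, Npre, Finset.mem_univ, true_and]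
  refine and_congr_left fun _ => or_congr_right ?_
  constructor
  · rintro ⟨c, hc, ⟨rfl, h⟩ | ⟨h, rfl⟩⟩
    · exact .inl ⟨hc, h⟩
    · exact .inr ⟨hc, h⟩
  · rintro (⟨hc, h⟩ | ⟨hc, h⟩)
    · exact ⟨a, hc, .inl ⟨rfl, h⟩⟩
    · exact ⟨b, hc, .inr ⟨h, rfl⟩⟩

theorem isDFVS_manyfoldGraph_of_subset {G : Dgraph V} {v : V} {C1 C2 : Finset V} {f : V → V}
    {D D' : Finset V} (hD : IsDFVS G D) (hC1 : C1 ⊆ D')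
    (hD' : ∀ x, x ∉ D' → x ∉ insert v C2 → x ∉ D) :
    IsDFVS (manyfoldGraph G v C1 C2 f) D' := by
  rw [isDFVS_iff] at hD ⊢
  intro x hx
  refine hD x (Relation.TransGen.mono ?_ _ _ hx)
  rintro a b ⟨hab, ha, hb⟩
  obtain ⟨h, ha', hb', -⟩ := mem_manyfoldGraph.1 hab
  refine ⟨?_, hD' a ha ha', hD' b hb hb'⟩
  rcases h with h | ⟨h, -⟩ | ⟨h, -⟩
  · exact h
  · exact (ha (hC1 h)).elim
  · exact (hb (hC1 h)).elim

/-- Two vertices joined by a bi-edge cannot both avoid a DFVS. -/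
theorem IsDFVS.mem_or_mem {G : Dgraph V} {D : Finset V} (hD : IsDFVS G D) {a b : V}
    (h1 : (a, b) ∈ G) (h2 : (b, a) ∈ G) : a ∈ D ∨ b ∈ D := by
  by_contra! h
  exact isDFVS_iff.1 hD a (.head ⟨h1, h⟩ (.single ⟨h2, h.symm⟩))

/-- A path avoiding a DFVS is uncovered. -/
theorem IsDFVS.uncovered {G : Dgraph V} {D : Finset V} (hD : IsDFVS G D) {p : List V}
    (hp : ∀ x ∈ p, x ∉ D) : Uncovered G p := by
  rintro ⟨q, hq, hqp⟩
  obtain ⟨x, hx, hxD⟩ := hD q hq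
  exact hp x (List.mem_toFinset.1 (hqp.1 (List.mem_toFinset.2 hx))) hxD

theorem card_sdiff_add_card_le {D K S : Finset V} (hSD : S ⊆ D) (hSK : S ⊆ K) :
    (D \ K).card + S.card ≤ D.card := by
  rw [← Finset.card_union_of_disjoint]
  · exact Finset.card_le_card (Finset.union_subset Finset.sdiff_subset hSD)
  · exact Finset.disjoint_of_subset_right hSK Finset.sdiff_disjoint

/-- If a DFVS of `G` contains `v` and all its neighbours except `c` and `f c`, it restricts to
a DFVS of the reduced digraph. -/
theorem isDFVS_manyfoldGraph_sdiff {G : Dgraph V} {v : V} {C1 C2 : Finset V} {f : V → V}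
    {D : Finset V} {c : V} (hD : IsDFVS G D)
    (hcD : c ∉ D) (hfD : f c ∉ D) (hC1 : ∀ x ∈ C1, x ∉ D → x = c)
    (hcN : c ∈ Nbhd G v) (hfN : f c ∈ Nbhd G v) (hne : c ≠ f c)
    (hM : ∀ c d : V, inM G v c d →
      (inM G v d c ∧ NoUncoveredPathBetween G c d) ∨
      (¬ inM G v d c ∧
        ∀ p : List V, IsPathFrom G d c p → Uncovered G p →
          (d, c) ∈ consecutivePairs p))
    (hfC2 : f c ∈ C2) :
    IsDFVS (manyfoldGraph G v C1 C2 f) (D \ insert v C2) := by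
  have hac := isDFVS_iff.1 hD
  set r : V → V → Prop := fun a b =>
    AvoidArc G D a b ∧ ¬ (a = c ∧ b = f c) ∧ ¬ (a = f c ∧ b = c) with hr
  have hsub : ∀ {a b}, Relation.TransGen r a b → Relation.TransGen (AvoidArc G D) a b :=
    fun h => Relation.TransGen.mono (fun _ _ h => h.1) _ _ h
  have hpath : ∀ x y : V, x ∈ Nbhd G v → y ∈ Nbhd G v → x ≠ y → x ∉ D → y ∉ D →
      (∀ a b, r a b → ¬ (a = y ∧ b = x)) → ¬ Relation.TransGen r y x := by
    intro x y hx hy hxy hxD hyD hnot h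
    by_cases hG : (x, y) ∈ G
    · exact hac x (.head ⟨hG, hxD, hyD⟩ (hsub h))
    obtain ⟨p, h1, h2, h3, -, h5, h6⟩ :=
      exists_list_of_transGen (P := fun z => z ∉ D) (fun _ _ h => h.1.2) h
    have hp : IsPathFrom G y x p := ⟨h1.imp fun _ _ h => h.1.1, h2, h3⟩
    have hu : Uncovered G p := hD.uncovered h5
    rcases hM x y ⟨hx, hy, hxy, hG⟩ with ⟨-, hno⟩ | ⟨-, huse⟩
    · exact hno ⟨p, .inr hp, hu⟩
    · exact hnot _ _ (h6 _ (huse p hp hu)) ⟨rfl, rfl⟩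
  have hcyc : ∀ x, ¬ Relation.TransGen r x x := fun x h => hac x (hsub h)
  have h12 := hpath (f c) c hfN hcN hne.symm hfD hcD fun a b h => h.2.1
  have h21 := hpath c (f c) hcN hfN hne hcD hfD fun a b h => h.2.2
  rw [isDFVS_iff]
  refine acyclic_of_merge {c, f c} hcyc ?_ ?_
  · rintro x (rfl | rfl) y (rfl | rfl)
    exacts [hcyc _, h12, h21, hcyc _]
  · rintro a b ⟨hab, ha, hb⟩
    obtain ⟨h, ha', hb', hne'⟩ := mem_manyfoldGraph.1 hab
    have haD : a ∉ D := fun h => ha (Finset.mem_sdiff.2 ⟨h, ha'⟩)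
    have hbD : b ∉ D := fun h => hb (Finset.mem_sdiff.2 ⟨h, hb'⟩)
    have haf : a ≠ f c := by
      rintro rfl
      exact ha' (Finset.mem_insert_of_mem hfC2)
    have hbf : b ≠ f c := by
      rintro rfl
      exact hb' (Finset.mem_insert_of_mem hfC2)
    rcases h with h | ⟨haC, h⟩ | ⟨hbC, h⟩
    · exact ⟨a, b, .inl rfl, .inl rfl, ⟨h, haD, hbD⟩, fun h => hbf h.2, fun h => haf h.1⟩
    · obtain rfl := hC1 a haC haD
      exact ⟨f a, b, .inr ⟨by simp, by simp⟩, .inl rfl, ⟨h, hfD, hbD⟩, fun h => hbf h.2,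
        fun h => hne' h.2.symm⟩
    · obtain rfl := hC1 b hbC hbD
      exact ⟨a, f b, .inl rfl, .inr ⟨by simp, by simp⟩, ⟨h, haD, hfD⟩, fun h => hne' h.1,
        fun h => haf h.1⟩

/-- A DFVS of the reduced digraph missing `c ∈ C1` lifts to a DFVS of `G`. -/
theorem isDFVS_of_manyfoldGraph {G : Dgraph V} {v : V} {C1 C2 : Finset V} {f : V → V}
    {D : Finset V} {c : V} (hloop : ∀ x : V, (x, x) ∉ G)
    (hD : IsDFVS (manyfoldGraph G v C1 C2 f) D) (hc : c ∈ C1) (hcD : c ∉ D)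
    (hcK : c ∉ insert v C2) (hne : c ≠ f c) (hnb : ¬ ((c, f c) ∈ G ∧ (f c, c) ∈ G)) :
    IsDFVS G (D ∪ insert v (C2.erase (f c))) := by
  rw [isDFVS_iff] at hD ⊢
  set g : V → V := fun x => if x = f c then c else x with hg
  have hgc : g c = c := by simp [hg]
  have hgf : g (f c) = c := by simp [hg]
  have hgo : ∀ {x}, x ≠ f c → g x = x := fun h => by simp [hg, h]
  have key : ∀ a b, Relation.TransGen (AvoidArc G (D ∪ insert v (C2.erase (f c)))) a b →
      Relation.TransGen (AvoidArc (manyfoldGraph G v C1 C2 f) D) (g a) (g b) ∨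
        (a = c ∧ b = f c ∧ (c, f c) ∈ G) ∨ (a = f c ∧ b = c ∧ (f c, c) ∈ G) := by
    have hstep : ∀ a b, AvoidArc G (D ∪ insert v (C2.erase (f c))) a b →
        AvoidArc (manyfoldGraph G v C1 C2 f) D (g a) (g b) ∨
        (a = c ∧ b = f c ∧ (c, f c) ∈ G) ∨ (a = f c ∧ b = c ∧ (f c, c) ∈ G) := by
      rintro a b ⟨hab, ha, hb⟩
      have hout : ∀ x, x ∉ D ∪ insert v (C2.erase (f c)) → x ≠ f c →
          x ∉ D ∧ x ∉ insert v C2 := by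
        intro x hx hxf
        simp only [Finset.mem_union, Finset.mem_insert, Finset.mem_erase] at hx ⊢
        tauto
      by_cases haf : a = f c
      · subst haf
        by_cases hbf : b = f c
        · subst hbf
          exact (hloop _ hab).elim
        by_cases hbc : b = c
        · subst hbc
          exact .inr (.inr ⟨rfl, rfl, hab⟩)
        obtain ⟨hb1, hb2⟩ := hout b hb hbf
        rw [hgf, hgo hbf]
        exact .inl ⟨mem_manyfoldGraph.2 ⟨.inr (.inl ⟨hc, hab⟩), hcK, hb2, Ne.symm hbc⟩, hcD, hb1⟩
      · obtain ⟨ha1, ha2⟩ := hout a ha haf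
        by_cases hbf : b = f c
        · subst hbf
          by_cases hac : a = c
          · subst hac
            exact .inr (.inl ⟨rfl, rfl, hab⟩)
          rw [hgf, hgo haf]
          exact .inl ⟨mem_manyfoldGraph.2 ⟨.inr (.inr ⟨hc, hab⟩), ha2, hcK, hac⟩, ha1, hcD⟩
        · obtain ⟨hb1, hb2⟩ := hout b hb hbf
          rw [hgo haf, hgo hbf]
          refine .inl ⟨mem_manyfoldGraph.2 ⟨.inl hab, ha2, hb2, ?_⟩, ha1, hb1⟩
          rintro rfl
          exact hloop _ hab
    intro a b h
    induction h with
    | single h => exact (hstep _ _ h).imp_left .single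
    | tail _ h ih =>
      rcases ih with ih | ⟨rfl, rfl, h1⟩ | ⟨rfl, rfl, h1⟩ <;>
        rcases hstep _ _ h with h | ⟨h2, rfl, h3⟩ | ⟨h2, rfl, h3⟩
      · exact .inl (ih.tail h)
      · exact .inl (by rwa [h2, hgc, ← hgf] at ih)
      · exact .inl (by rwa [h2, hgf, ← hgc] at ih)
      · exact .inl (by rw [hgc, ← hgf]; exact .single h)
      · exact (hne h2.symm).elim
      · exact (hnb ⟨h1, h3⟩).elim
      · exact .inl (by rw [hgf, ← hgc]; exact .single h)
      · exact (hnb ⟨h3, h1⟩).elim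
      · exact (hne h2).elim
  intro x hx
  rcases key x x hx with h | ⟨h1, h2, -⟩ | ⟨h1, h2, -⟩
  · exact hD _ h
  · exact hne (h1.symm.trans h2)
  · exact hne (h2.symm.trans h1)

/-- soundness of MANYFOLD. -/
theorem manyfold_sound (G : Dgraph V) (vstar : V)
    (hloopfree : ∀ x : V, (x, x) ∉ G)
    (hnoPIE : ¬ ∃ u v : V, (u, v) ∈ G ∧ (v, u) ∉ G ∧
      ∀ p : List V, IsPathFrom G v u p → UsesBiEdge G p)
    (hbi : Nbhd G vstar = Nbi G vstar)
    (C1 C2 : Finset V)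
    (hunion : C1 ∪ C2 = Nbhd G vstar) (hdisj : Disjoint C1 C2)
    (hcard : C2.card ≤ C1.card)
    (hd1 : IsDiclique G C1) (hd2 : IsDiclique G C2)
    (hM : ∀ c d : V, inM G vstar c d →
      (inM G vstar d c ∧ NoUncoveredPathBetween G c d) ∨
      (¬ inM G vstar d c ∧
        ∀ p : List V, IsPathFrom G d c p → Uncovered G p →
          (d, c) ∈ consecutivePairs p))
    (f : V → V)
    (hf : ∀ c1 ∈ C1, f c1 ∈ C2 ∧ (inM G vstar c1 (f c1) ∨ inM G vstar (f c1) c1) ∧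
      ∀ c2 ∈ C2, (inM G vstar c1 c2 ∨ inM G vstar c2 c1) → c2 = f c1) :
    dfvsNum G = dfvsNum (manyfoldGraph G vstar C1 C2 f) + C2.card := by
  have hbiN : ∀ x ∈ Nbhd G vstar, (vstar, x) ∈ G ∧ (x, vstar) ∈ G := by
    intro x hx
    rw [hbi] at hx
    simp only [Nbi, Npre, Nsucc, Finset.mem_inter, Finset.mem_filter, Finset.mem_univ,
      true_and] at hx
    exact ⟨hx.2, hx.1⟩
  have hC1N : ∀ x ∈ C1, x ∈ Nbhd G vstar := fun x hx => hunion ▸ Finset.mem_union_left _ hx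
  have hC2N : ∀ x ∈ C2, x ∈ Nbhd G vstar := fun x hx => hunion ▸ Finset.mem_union_right _ hx
  have hvN : vstar ∉ Nbhd G vstar := fun h => hloopfree _ (hbiN _ h).1
  have hvC2 : vstar ∉ C2 := fun h => hvN (hC2N _ h)
  have hC1K : ∀ x ∈ C1, x ∉ insert vstar C2 := by
    intro x hx h
    rcases Finset.mem_insert.1 h with rfl | h
    · exact hvN (hC1N _ hx)
    · exact Finset.disjoint_left.1 hdisj hx h
  have hne : ∀ x ∈ C1, ∀ y ∈ C2, x ≠ y := fun x hx y hy h =>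
    Finset.disjoint_left.1 hdisj hx (h ▸ hy)
  apply le_antisymm
  · obtain ⟨D, hD, hcardD⟩ := exists_isDFVS_card_eq_dfvsNum (manyfoldGraph G vstar C1 C2 f)
    rw [← hcardD]
    by_cases hC1 : C1 ⊆ D
    · refine (dfvsNum_le (D := D ∪ C2) ?_).trans (Finset.card_union_le _ _)
      rw [isDFVS_iff] at hD ⊢
      have hv : ∀ x, x ∉ D ∪ C2 → x ∉ Nbhd G vstar := by
        intro x hx h
        rw [← hunion] at h
        simp only [Finset.mem_union, not_or] at hx h
        exact h.elim (fun h => hx.1 (hC1 h)) hx.2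
      have hK : ∀ a b, a ∉ D ∪ C2 → b ∉ D ∪ C2 → (a, b) ∈ G →
          a ≠ vstar ∧ b ≠ vstar := by
        intro a b ha hb hab
        constructor
        · rintro rfl
          exact hv b hb (by simp [Nbhd, Npre, Nsucc, hab])
        · rintro rfl
          exact hv a ha (by simp [Nbhd, Npre, Nsucc, hab])
      intro x hx
      refine hD x (Relation.TransGen.mono ?_ _ _ hx)
      rintro a b ⟨hab, ha, hb⟩
      obtain ⟨hav, hbv⟩ := hK a b ha hb hab
      simp only [Finset.mem_union, not_or] at ha hb
      refine ⟨mem_manyfoldGraph.2 ⟨.inl hab, ?_, ?_, ?_⟩, ha.1, hb.1⟩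
      · simp [hav, ha.2]
      · simp [hbv, hb.2]
      · rintro rfl
        exact hloopfree _ hab
    · obtain ⟨c, hc, hcD⟩ := Finset.not_subset.1 hC1
      obtain ⟨hfc, hin, -⟩ := hf c hc
      have hnb : ¬ ((c, f c) ∈ G ∧ (f c, c) ∈ G) := by
        rintro ⟨h1, h2⟩
        rcases hin with h | h
        · exact h.2.2.2 h1
        · exact h.2.2.2 h2
      refine (dfvsNum_le (isDFVS_of_manyfoldGraph hloopfree hD hc hcD (hC1K c hc)
        (hne c hc _ hfc) hnb)).trans ((Finset.card_union_le _ _).trans ?_)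
      rw [Finset.card_insert_of_notMem fun h => hvC2 (Finset.mem_of_mem_erase h),
        Finset.card_erase_add_one hfc]
  · obtain ⟨D, hD, hcardD⟩ := exists_isDFVS_card_eq_dfvsNum G
    rw [← hcardD]
    suffices ∃ D', IsDFVS (manyfoldGraph G vstar C1 C2 f) D' ∧ D'.card + C2.card ≤ D.card by
      obtain ⟨D', hD', h⟩ := this
      exact (Nat.add_le_add_right (dfvsNum_le hD') _).trans h
    have hrest : ∀ {x}, x ∈ D → x ∉ insert vstar C2 → x ∈ D \ insert vstar C2 :=
      fun h1 h2 => Finset.mem_sdiff.2 ⟨h1, h2⟩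
    have hfull : ∀ S ⊆ D, S ⊆ insert vstar C2 → C2.card = S.card → C1 ⊆ D →
        ∃ D', IsDFVS (manyfoldGraph G vstar C1 C2 f) D' ∧ D'.card + C2.card ≤ D.card := by
      intro S hSD hSK hS hC1
      refine ⟨D \ insert vstar C2, ?_, hS ▸ card_sdiff_add_card_le hSD hSK⟩
      exact isDFVS_manyfoldGraph_of_subset hD (fun x hx => hrest (hC1 hx) (hC1K x hx))
        fun x h1 h2 h3 => h1 (hrest h3 h2)
    by_cases hv : vstar ∈ D
    · by_cases hC2 : C2 ⊆ D
      · by_cases hC1 : C1 ⊆ D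
        · exact hfull C2 hC2 (Finset.subset_insert _ _) rfl hC1
        · obtain ⟨c, hc, hcD⟩ := Finset.not_subset.1 hC1
          refine ⟨insert c (D \ insert vstar C2), ?_, ?_⟩
          · refine isDFVS_manyfoldGraph_of_subset hD (fun x hx => ?_) fun x h1 h2 h3 =>
              h1 (Finset.mem_insert_of_mem (hrest h3 h2))
            by_cases hxc : x = c
            · exact hxc ▸ Finset.mem_insert_self _ _
            · obtain ⟨h1, h2⟩ := hd1 x hx c hc hxc
              exact Finset.mem_insert_of_mem
                (hrest ((hD.mem_or_mem h1 h2).resolve_right hcD) (hC1K x hx))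
          · have h1 := card_sdiff_add_card_le (Finset.insert_subset hv hC2)
              (Finset.Subset.refl (insert vstar C2))
            rw [Finset.card_insert_of_notMem hvC2] at h1
            have h2 := Finset.card_insert_le c (D \ insert vstar C2)
            omega
      · obtain ⟨d, hd, hdD⟩ := Finset.not_subset.1 hC2
        have hSD : insert vstar (C2.erase d) ⊆ D := by
          refine Finset.insert_subset hv fun x hx => ?_
          obtain ⟨hxd, hx⟩ := Finset.mem_erase.1 hx
          obtain ⟨h1, h2⟩ := hd2 x hx d hd hxd
          exact (hD.mem_or_mem h1 h2).resolve_right hdD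
        have hSK : insert vstar (C2.erase d) ⊆ insert vstar C2 :=
          Finset.insert_subset_insert _ (Finset.erase_subset _ _)
        have hS : C2.card = (insert vstar (C2.erase d)).card := by
          rw [Finset.card_insert_of_notMem fun h => hvC2 (Finset.mem_of_mem_erase h),
            Finset.card_erase_add_one hd]
        by_cases hC1 : C1 ⊆ D
        · exact hfull _ hSD hSK hS hC1
        · obtain ⟨c, hc, hcD⟩ := Finset.not_subset.1 hC1
          obtain ⟨hfc, -, huniq⟩ := hf c hc
          obtain rfl : d = f c := by
            apply huniq d hd
            by_contra! h
            have h1 : (c, d) ∈ G := by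
              by_contra hcd
              exact h.1 ⟨hC1N c hc, hC2N d hd, hne c hc d hd, hcd⟩
            have h2 : (d, c) ∈ G := by
              by_contra hcd
              exact h.2 ⟨hC2N d hd, hC1N c hc, (hne c hc d hd).symm, hcd⟩
            exact (hD.mem_or_mem h1 h2).elim hcD hdD
          refine ⟨D \ insert vstar C2, ?_, hS ▸ card_sdiff_add_card_le hSD hSK⟩
          refine isDFVS_manyfoldGraph_sdiff hD hcD hdD (fun x hx hxD => ?_) (hC1N c hc)
            (hC2N _ hd) (hne c hc _ hd) hM hd
          by_contra hxc
          obtain ⟨h1, h2⟩ := hd1 x hx c hc hxc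
          exact (hD.mem_or_mem h1 h2).elim hxD hcD
    · have hN : ∀ x ∈ Nbhd G vstar, x ∈ D := fun x hx =>
        (hD.mem_or_mem (hbiN x hx).1 (hbiN x hx).2).resolve_left hv
      exact hfull C2 (fun x hx => hN x (hC2N x hx)) (Finset.subset_insert _ _) rfl
        fun x hx => hN x (hC1N x hx)

end

end DFVSP
end

section
/- Let G be a digraph and (d,c) ∈ E(G) a straight arc, i.e., (c,d) ∉ E(G) and either (i) every arc (d,c') ∈ E(G) with c' ≠ c is a bi-edge, or (ii) every arc (d',c) ∈ E(G) with d' ≠ d is a bi-edge. Then every uncovered path in G that starts at d and ends at c uses the arc (d,c). -/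
namespace DFVSP

open scoped Classical

noncomputable section

variable {V : Type*} [Fintype V] [DecidableEq V]

/-- If an uncovered path contains both ends of a bi-edge, it has no other vertices. -/
theorem Uncovered.eq_or_eq_of_biEdge {G : Dgraph V} {p : List V} (hp : Uncovered G p)
    {a b z : V} (ha : a ∈ p) (hb : b ∈ p) (hz : z ∈ p)
    (hab : (a, b) ∈ G) (hba : (b, a) ∈ G) : z = a ∨ z = b := by
  by_contra! h
  refine hp ⟨[a, b, a], ⟨?_, by simp, by simp⟩, ?_⟩
  · simp [IsPath, List.Chain', hab, hba]
  · rw [Finset.ssubset_iff_of_subset]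
    · exact ⟨z, by simpa using hz, by simp [h.1, h.2]⟩
    · intro x hx
      simp only [List.mem_toFinset, List.mem_cons, List.not_mem_nil, or_false] at hx ⊢
      rcases hx with rfl | rfl | rfl <;> assumption

/-- A path between distinct vertices starts with an arc out of its first vertex. -/
theorem IsPathFrom.exists_first_arc {G : Dgraph V} {d c : V} {p : List V}
    (h : IsPathFrom G d c p) (hne : d ≠ c) :
    ∃ x, (d, x) ∈ G ∧ (d, x) ∈ consecutivePairs p := by
  obtain ⟨hp, hd, hc⟩ := h
  match p with
  | [] => simp at hd
  | [a] => simp_all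
  | a :: x :: l =>
    obtain rfl : a = d := by simpa using hd
    exact ⟨x, (List.isChain_cons_cons.mp hp).1, by simp [consecutivePairs]⟩

/-- A path between distinct vertices ends with an arc into its last vertex. -/
theorem IsPathFrom.exists_last_arc {G : Dgraph V} {d c : V} {p : List V}
    (h : IsPathFrom G d c p) (hne : d ≠ c) :
    ∃ y, (y, c) ∈ G ∧ (y, c) ∈ consecutivePairs p := by
  induction p generalizing d with
  | nil => simp [IsPathFrom] at h
  | cons a l ih =>
    obtain ⟨hp, hd, hc⟩ := h
    obtain rfl : a = d := by simpa using hd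
    match l with
    | [] => simp_all
    | x :: l =>
      obtain ⟨hax, hl⟩ := List.isChain_cons_cons.mp hp
      by_cases hx : x = c
      · subst hx
        exact ⟨a, hax, by simp [consecutivePairs]⟩
      · obtain ⟨y, hy, hmem⟩ := ih ⟨hl, rfl, by simpa using hc⟩ hx
        exact ⟨y, hy, List.mem_cons_of_mem _ hmem⟩

/-- every uncovered path from `d` to `c` uses a straight arc `(d, c)`. -/
theorem straight_arc_used (G : Dgraph V) (d c : V)
    (hdc : (d, c) ∈ G) (hcd : (c, d) ∉ G)
    (hstraight :
      (∀ c' : V, (d, c') ∈ G → c' ≠ c → (c', d) ∈ G) ∨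
      (∀ d' : V, (d', c) ∈ G → d' ≠ d → (c, d') ∈ G)) :
    ∀ p : List V, IsPathFrom G d c p → Uncovered G p →
      (d, c) ∈ consecutivePairs p := by
  intro p hp hunc
  have hne : d ≠ c := by
    rintro rfl
    exact hcd hdc
  have hd : d ∈ p := List.mem_of_mem_head? hp.2.1
  have hc : c ∈ p := List.mem_of_mem_getLast? hp.2.2
  rcases hstraight with h | h
  · obtain ⟨x, hx, hmem⟩ := hp.exists_first_arc hne
    by_cases hxc : x = c
    · rwa [← hxc]
    · have hxp : x ∈ p := List.mem_of_mem_tail (List.of_mem_zip hmem).2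
      rcases hunc.eq_or_eq_of_biEdge hd hxp hc hx (h x hx hxc) with e | e
      · exact absurd e.symm hne
      · exact absurd e.symm hxc
  · obtain ⟨y, hy, hmem⟩ := hp.exists_last_arc hne
    by_cases hyd : y = d
    · rwa [← hyd]
    · have hyp : y ∈ p := (List.of_mem_zip hmem).1
      rcases hunc.eq_or_eq_of_biEdge hyp hc hd hy (h y hy hyd) with e | e
      · exact absurd e.symm hyd
      · exact absurd e hne

end

end DFVSP
end

section
/- (Soundness of INDICLIQUE) Let G be a digraph and v ∈ V(G) a vertex with (v,v) ∉ E(G) such that the set of predecessors N_pre(v) forms a diclique in G. Then DFVS(G) = DFVS(G∘v), and every DFVS of G∘v is a DFVS of G. -/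
namespace DFVSP

open scoped Classical

noncomputable section

variable {V : Type*} [Fintype V] [DecidableEq V]

theorem isDFVS_iff_transGen {W : Type*} (G : Dgraph W) (D : Finset W) :
    IsDFVS G D ↔ ∀ x, ¬ Relation.TransGen (AvoidArc G D) x x := by
  constructor
  · intro h x hx
    obtain ⟨y, hxy, hyx⟩ := Relation.TransGen.head'_iff.1 hx
    obtain ⟨l, hl, hlast⟩ := List.exists_isChain_cons_of_relationReflTransGen hyx
    have hchain : List.IsChain (AvoidArc G D) (x :: y :: l) := .cons_cons hxy hl
    obtain ⟨z, hz, hzD⟩ := h (x :: y :: l)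
      ⟨List.IsChain.imp (fun _ _ h => h.1) hchain, by simp, by
        rw [List.getLast?_cons_cons, List.getLast?_eq_some_getLast (List.cons_ne_nil y l), hlast]
        rfl⟩
    exact List.IsChain.induction (fun w => w ∉ D) _ hchain (fun _ _ h _ => h.2.2)
      (fun _ => hxy.2.1) z hz hzD
  · rintro h p ⟨hp, hlen, hends⟩
    by_contra! hD
    match p, hp, hlen, hends, hD with
    | a :: b :: l, hp, _, hends, hD =>
      have hchain : List.IsChain (AvoidArc G D) (a :: b :: l) := by
        refine List.IsChain.imp_of_mem_imp ?_ hp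
        intro x y hx hy hxy
        exact ⟨hxy, hD x hx, hD y hy⟩
      obtain ⟨hab, hbl⟩ := List.isChain_cons_cons.1 hchain
      refine h a (Relation.TransGen.head'_iff.2 ⟨b, hab, ?_⟩)
      refine List.relationReflTransGen_of_exists_isChain_cons l hbl ?_
      rw [List.getLast?_cons_cons, List.getLast?_eq_some_getLast (List.cons_ne_nil b l)] at hends
      exact (Option.some.inj hends).symm

theorem mem_exclude {G : Dgraph V} {v a b : V} :
    (a, b) ∈ exclude G v ↔
      ((a, b) ∈ G ∧ a ≠ v ∧ b ≠ v) ∨ ((a, v) ∈ G ∧ (v, b) ∈ G) := by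
  simp [exclude, deleteVertex, Npre, Nsucc]

theorem isDFVS_univ {W : Type*} [Fintype W] (G : Dgraph W) : IsDFVS G Finset.univ := by
  rw [isDFVS_iff_transGen]
  intro x hx
  obtain ⟨y, hxy, -⟩ := Relation.TransGen.head'_iff.1 hx
  exact hxy.2.1 (Finset.mem_univ x)

theorem dfvsNum_le_of_forall_isDFVS {W : Type*} [Fintype W] {G H : Dgraph W}
    (h : ∀ D, IsDFVS H D → ∃ D', IsDFVS G D' ∧ D'.card ≤ D.card) :
    dfvsNum G ≤ dfvsNum H := by
  obtain ⟨D, hD, hcard⟩ :=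
    Nat.sInf_mem (s := {n | ∃ D : Finset W, IsDFVS H D ∧ D.card = n})
      ⟨_, Finset.univ, isDFVS_univ H, rfl⟩
  obtain ⟨D', hD', hle⟩ := h D hD
  calc dfvsNum G ≤ D'.card := Nat.sInf_le ⟨D', hD', rfl⟩
    _ ≤ D.card := hle
    _ = dfvsNum H := hcard

theorem transGen_exclude {G : Dgraph V} {v : V} (hloop : (v, v) ∉ G) {D : Finset V} {a b : V}
    (ha : a ≠ v) (h : Relation.TransGen (AvoidArc G D) a b) :
    (b ≠ v → Relation.TransGen (AvoidArc (exclude G v) D) a b) ∧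
      (b = v → ∃ p, (p, v) ∈ G ∧ p ∉ D ∧
        Relation.ReflTransGen (AvoidArc (exclude G v) D) a p) := by
  induction h with
  | single hab =>
    refine ⟨fun hb => .single ⟨mem_exclude.2 (.inl ⟨hab.1, ha, hb⟩), hab.2⟩, ?_⟩
    rintro rfl
    exact ⟨a, hab.1, hab.2.1, .refl⟩
  | @tail b c _ hbc ih =>
    by_cases hb : b = v
    · obtain ⟨p, hpv, hpD, hap⟩ := ih.2 hb
      subst hb
      refine ⟨fun _ => .tail' hap ⟨mem_exclude.2 (.inr ⟨hpv, hbc.1⟩), hpD, hbc.2.2⟩, ?_⟩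
      rintro rfl
      exact absurd hbc.1 hloop
    · refine ⟨fun hc => (ih.1 hb).tail ⟨mem_exclude.2 (.inl ⟨hbc.1, hb, hc⟩), hbc.2⟩, ?_⟩
      rintro rfl
      exact ⟨b, hbc.1, hbc.2.1, (ih.1 hb).to_reflTransGen⟩

theorem IsDFVS.of_exclude {G : Dgraph V} {v : V} (hloop : (v, v) ∉ G) {D : Finset V}
    (hD : IsDFVS (exclude G v) D) : IsDFVS G D := by
  rw [isDFVS_iff_transGen] at hD ⊢
  have key : ∀ x, x ≠ v → ¬ Relation.TransGen (AvoidArc G D) x x := fun x hx h =>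
    hD x ((transGen_exclude hloop hx h).1 hx)
  intro x hx
  by_cases hxv : x = v
  · obtain ⟨y, hxy, hyx⟩ := Relation.TransGen.head'_iff.1 hx
    refine key y ?_ (.tail' hyx hxy)
    rintro rfl
    exact hloop (hxv ▸ hxy.1)
  · exact key x hxv hx

theorem IsDFVS.exclude_of_notMem {G : Dgraph V} {v : V} {D : Finset V} (hD : IsDFVS G D)
    (hv : v ∉ D) : IsDFVS (exclude G v) D := by
  rw [isDFVS_iff_transGen] at hD ⊢
  refine fun x hx => hD x (hx.lift' id fun a b hab => ?_)
  rcases mem_exclude.1 hab.1 with h | h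
  · exact .single ⟨h.1, hab.2⟩
  · exact .tail (.single ⟨h.1, hab.2.1, hv⟩) ⟨h.2, hv, hab.2.2⟩

theorem IsDFVS.exclude_of_Npre_subset {G : Dgraph V} {v : V} {D D' : Finset V} (hD : IsDFVS G D)
    (hsub : D ⊆ insert v D') (hpre : Npre G v ⊆ D') : IsDFVS (exclude G v) D' := by
  rw [isDFVS_iff_transGen] at hD ⊢
  refine fun x hx => hD x (hx.lift id fun a b hab => ?_)
  rcases mem_exclude.1 hab.1 with h | h
  · exact ⟨h.1, fun ha => ((Finset.mem_insert.1 (hsub ha)).elim h.2.1 hab.2.1),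
      fun hb => ((Finset.mem_insert.1 (hsub hb)).elim h.2.2 hab.2.2)⟩
  · exact absurd (hpre (by simpa [Npre] using h.1)) hab.2.1

theorem IsDFVS.exists_exclude_card_le {G : Dgraph V} {v : V} (hloop : (v, v) ∉ G)
    (hin : IsDiclique G (Npre G v)) {D : Finset V} (hD : IsDFVS G D) :
    ∃ D', IsDFVS (exclude G v) D' ∧ D'.card ≤ D.card := by
  by_cases hv : v ∈ D
  swap
  · exact ⟨D, hD.exclude_of_notMem hv, le_rfl⟩
  by_cases hpre : Npre G v ⊆ D
  · exact ⟨D, hD.exclude_of_Npre_subset (Finset.subset_insert v D) hpre, le_rfl⟩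
  obtain ⟨p, hp, hpD⟩ := Finset.not_subset.1 hpre
  refine ⟨insert p (D.erase v), hD.exclude_of_Npre_subset ?_ ?_, ?_⟩
  · intro x hx
    by_cases hxv : x = v <;> simp [hxv, hx]
  · intro q hq
    by_cases hqp : q = p
    · simp [hqp]
    have hqv : q ≠ v := by
      rintro rfl
      exact hloop (by simpa [Npre] using hq)
    have hqD : q ∈ D := by
      by_contra hqD
      obtain ⟨hqp', hpq⟩ := hin q hq p hp hqp
      exact (isDFVS_iff_transGen G D).1 hD q
        (.tail (.single ⟨hqp', hqD, hpD⟩) ⟨hpq, hpD, hqD⟩)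
    simp [hqv, hqD]
  · calc (insert p (D.erase v)).card ≤ (D.erase v).card + 1 := Finset.card_insert_le _ _
      _ = D.card := Finset.card_erase_add_one hv

/-- soundness of INDICLIQUE. -/
theorem indiclique_sound (G : Dgraph V) (v : V) (hloop : (v, v) ∉ G)
    (hin : IsDiclique G (Npre G v)) :
    dfvsNum G = dfvsNum (exclude G v) ∧
      ∀ D : Finset V, IsDFVS (exclude G v) D → IsDFVS G D := by
  refine ⟨le_antisymm ?_ ?_, fun D hD => hD.of_exclude hloop⟩
  · exact dfvsNum_le_of_forall_isDFVS fun D hD => ⟨D, hD.of_exclude hloop, le_rfl⟩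
  · exact dfvsNum_le_of_forall_isDFVS fun D hD => hD.exists_exclude_card_le hloop hin

end

end DFVSP
end

section
/- (Soundness of DOME) Let G be a digraph and (v,u) ∈ E(G) an arc with (u,v) ∉ E(G) such that either (i) every vertex p with (p,v) ∈ E(G) and (v,p) ∉ E(G) satisfies (p,u) ∈ E(G), or (ii) every vertex p with (u,p) ∈ E(G) and (p,u) ∉ E(G) satisfies (v,p) ∈ E(G). Then a set S ⊆ V(G) is a DFVS of G if and only if S is a DFVS of G − (v,u); in particular DFVS(G) = DFVS(G − (v,u)). -/
namespace DFVSP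

open scoped Classical

noncomputable section

variable {V : Type*} [Fintype V] [DecidableEq V]

/-- Adding a single pair `(v, u)` to a relation without cycles creates no cycle when every
predecessor of `v` is a predecessor of `u`. -/
theorem transGen_irrefl_of_pred_subset {α : Type*} {r s : α → α → Prop} {v u : α} (hne : v ≠ u)
    (hrs : ∀ x y, r x y → s x y ∨ x = v ∧ y = u) (hs : ∀ p, s p v → s p u)
    (hac : ∀ a, ¬ Relation.TransGen s a a) (a : α) : ¬ Relation.TransGen r a a := by
  have shift : ∀ {x}, Relation.TransGen s x v → Relation.TransGen s x u := by
    intro x hx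
    obtain ⟨p, hxp, hpv⟩ := Relation.TransGen.tail'_iff.1 hx
    exact Relation.TransGen.tail'_iff.2 ⟨p, hxp, hs p hpv⟩
  have key : ∀ {x y}, Relation.TransGen r x y →
      Relation.TransGen s x y ∨ x = v ∧ Relation.ReflTransGen s u y := by
    intro x y h
    induction h with
    | single h =>
      rcases hrs _ _ h with h | ⟨rfl, rfl⟩
      · exact .inl (.single h)
      · exact .inr ⟨rfl, .refl⟩
    | tail _ h ih =>
      rcases hrs _ _ h with h | ⟨rfl, rfl⟩
      · exact ih.imp (fun k => k.tail h) (fun k => ⟨k.1, k.2.tail h⟩)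
      · rcases ih with k | ⟨rfl, -⟩
        · exact .inl (shift k)
        · exact .inr ⟨rfl, .refl⟩
  intro h
  rcases key h with k | ⟨rfl, k⟩
  · exact hac _ k
  · rcases Relation.reflTransGen_iff_eq_or_transGen.1 k with rfl | k
    · exact hne rfl
    · exact hac _ (shift k)

/-- The arcs of `G` that avoid `S`, as a relation. -/
def ArcAvoiding (G : Dgraph V) (S : Finset V) (x y : V) : Prop :=
  (x, y) ∈ G ∧ x ∉ S ∧ y ∉ S

theorem exists_isPath_of_transGen {V : Type*} {G : Dgraph V} {S : Finset V} {a b : V}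
    (h : Relation.TransGen (ArcAvoiding G S) a b) :
    ∃ p : List V, IsPath G (a :: p) ∧ p.getLast? = some b ∧ ∀ x ∈ a :: p, x ∉ S := by
  induction h using Relation.TransGen.head_induction_on with
  | single h => exact ⟨[b], List.isChain_pair.2 h.1, rfl, by simpa using h.2⟩
  | head h _ ih =>
    obtain ⟨p, hp, hl, hS⟩ := ih
    refine ⟨_ :: p, List.isChain_cons_cons.2 ⟨h.1, hp⟩, by simp [List.getLast?_cons, hl], ?_⟩
    exact List.forall_mem_cons.2 ⟨h.2.1, hS⟩

theorem transGen_of_isPath_s18 {V : Type*} {G : Dgraph V} {S : Finset V} {a b c : V} {p : List V}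
    (hp : IsPath G (a :: b :: p)) (hl : (b :: p).getLast? = some c)
    (hS : ∀ x ∈ a :: b :: p, x ∉ S) : Relation.TransGen (ArcAvoiding G S) a c := by
  induction p generalizing a b with
  | nil =>
    obtain rfl : b = c := by simpa using hl
    exact .single ⟨(List.isChain_cons_cons.1 hp).1, hS a (by simp), hS b (by simp)⟩
  | cons d p ih =>
    obtain ⟨hab, hp⟩ := List.isChain_cons_cons.1 hp
    exact .head ⟨hab, hS a (by simp), hS b (by simp)⟩
      (ih hp (by simpa [List.getLast?_cons_cons] using hl)
        fun x hx => hS x (List.mem_cons_of_mem _ hx))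

theorem isDFVS_iff_transGen_irrefl {V : Type*} {G : Dgraph V} {S : Finset V} :
    IsDFVS G S ↔ ∀ a, ¬ Relation.TransGen (ArcAvoiding G S) a a := by
  constructor
  · intro h a ha
    obtain ⟨p, hp, hl, hS⟩ := exists_isPath_of_transGen ha
    have hne : p ≠ [] := by rintro rfl; simp at hl
    obtain ⟨x, hx, hxS⟩ := h (a :: p)
      ⟨hp, by have := List.length_pos_iff.2 hne; simp; omega, by simp [List.getLast?_cons, hl]⟩
    exact hS x hx hxS
  · rintro h p ⟨hp, hlen, hl⟩
    by_contra! hS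
    match p, hlen with
    | a :: b :: p, _ =>
      exact h a (transGen_of_isPath_s18 hp
        (by rw [List.getLast?_cons_cons] at hl; simpa using hl.symm) hS)

theorem isDFVS_erase_iff {V : Type*} [DecidableEq V] {G : Dgraph V} {v u : V}
    (hvu : (v, u) ∈ G) (huv : (u, v) ∉ G)
    (hdome :
      (∀ p : V, (p, v) ∈ G → (v, p) ∉ G → (p, u) ∈ G) ∨
      (∀ p : V, (u, p) ∈ G → (p, u) ∉ G → (v, p) ∈ G)) (S : Finset V) :
    IsDFVS G S ↔ IsDFVS (G.erase (v, u)) S := by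
  have hne : v ≠ u := by rintro rfl; exact huv hvu
  simp only [isDFVS_iff_transGen_irrefl]
  refine ⟨fun h a ha => h a (ha.lift id fun x y hxy => ⟨Finset.mem_of_mem_erase hxy.1, hxy.2⟩),
    fun h => ?_⟩
  by_cases hSvu : v ∉ S ∧ u ∉ S
  swap
  · intro a ha
    refine h a (ha.lift id fun x y hxy => ⟨Finset.mem_erase.2 ⟨?_, hxy.1⟩, hxy.2⟩)
    rintro ⟨⟩
    exact hSvu hxy.2
  have no_two_cycle : ∀ x y, ArcAvoiding (G.erase (v, u)) S x y →
      ¬ ArcAvoiding (G.erase (v, u)) S y x :=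
    fun x y hxy hyx => h x (.head hxy (.single hyx))
  have hrs : ∀ x y, ArcAvoiding G S x y →
      ArcAvoiding (G.erase (v, u)) S x y ∨ x = v ∧ y = u := by
    intro x y hxy
    by_cases heq : x = v ∧ y = u
    · exact .inr heq
    · exact .inl ⟨Finset.mem_erase.2 ⟨by simpa using heq, hxy.1⟩, hxy.2⟩
  rcases hdome with hd | hd
  · refine transGen_irrefl_of_pred_subset hne hrs (fun p hp => ?_) h
    have hpv := Finset.mem_of_mem_erase hp.1
    have hvp : (v, p) ∉ G := fun hvp => no_two_cycle _ _ hp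
      ⟨Finset.mem_erase.2 ⟨by rintro ⟨⟩; exact huv hpv, hvp⟩, hp.2.2, hp.2.1⟩
    exact ⟨Finset.mem_erase.2 ⟨by rintro ⟨⟩; exact hvp hpv, hd p hpv hvp⟩, hp.2.1, hSvu.2⟩
  · intro a ha
    refine transGen_irrefl_of_pred_subset (r := Function.swap (ArcAvoiding G S))
      (s := Function.swap (ArcAvoiding (G.erase (v, u)) S)) hne.symm
      (fun x y hxy => (hrs y x hxy).imp_right And.symm) (fun p hp => ?_)
      (fun b hb => h b (Relation.transGen_swap.1 hb)) a (Relation.transGen_swap.2 ha)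
    have hup := Finset.mem_of_mem_erase hp.1
    have hpu : (p, u) ∉ G := fun hpu => no_two_cycle _ _ hp
      ⟨Finset.mem_erase.2 ⟨by rintro ⟨⟩; exact huv hup, hpu⟩, hp.2.2, hp.2.1⟩
    exact ⟨Finset.mem_erase.2 ⟨by rintro ⟨⟩; exact hpu hup, hd p hup hpu⟩, hSvu.1, hp.2.2⟩

/-- soundness of DOME. -/
theorem dome_sound (G : Dgraph V) (v u : V)
    (hvu : (v, u) ∈ G) (huv : (u, v) ∉ G)
    (hdome :
      (∀ p : V, (p, v) ∈ G → (v, p) ∉ G → (p, u) ∈ G) ∨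
      (∀ p : V, (u, p) ∈ G → (p, u) ∉ G → (v, p) ∈ G)) :
    (∀ S : Finset V, IsDFVS G S ↔ IsDFVS (G.erase (v, u)) S) ∧
      dfvsNum G = dfvsNum (G.erase (v, u)) := by
  have h := isDFVS_erase_iff hvu huv hdome
  refine ⟨fun S => ?_, ?_⟩
  · convert h S
  · simp only [dfvsNum, h]

end

end DFVSP
end
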